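/- The map Φ(S₁, S₂) with s² = (1 + S₁·S₂)/2 preserves the inner product: if (S₁', S₂') = Φ(S₁, S₂) for unit vectors S₁, S₂ with S₁·S₂ ≠ -1, then S₁'·S₂' = S₁·S₂. -/

import Mathlib

/-- Dot product on `ℝ³`. -/
def dot3 (a b : Fin 3 → ℝ) : ℝ := a 0 * b 0 + a 1 * b 1 + a 2 * b 2

/-- The Krajnik-Prosen update map. -/
noncomputable def KPmap (Δt : ℝ) (S₁ S₂ : Fin 3 → ℝ) : (Fin 3 → ℝ) × (Fin 3 → ℝ) :=
  let s2 : ℝ := (1 + dot3 S₁ S₂) / 2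
  ((1 / (s2 + Δt ^ 2)) • (s2 • S₁ + Δt ^ 2 • S₂ + Δt • (crossProduct S₁ S₂)),
   (1 / (s2 + Δt ^ 2)) • (s2 • S₂ + Δt ^ 2 • S₁ + Δt • (crossProduct S₂ S₁)))

theorem dot3_smul_smul (r : ℝ) (a b : Fin 3 → ℝ) : dot3 (r • a) (r • b) = r ^ 2 * dot3 a b := by
  simp only [dot3, Pi.smul_apply, smul_eq_mul]
  ring

theorem neg_one_le_dot3 {a b : Fin 3 → ℝ} (ha : dot3 a a = 1) (hb : dot3 b b = 1) :
    -1 ≤ dot3 a b := by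
  simp only [dot3] at *
  linarith [sq_nonneg (a 0 + b 0), sq_nonneg (a 1 + b 1), sq_nonneg (a 2 + b 2)]

theorem dot3_add_crossProduct (p q r : ℝ) (a b : Fin 3 → ℝ) :
    dot3 (p • a + q • b + r • crossProduct a b) (p • b + q • a + r • crossProduct b a) =
      (p ^ 2 + q ^ 2) * dot3 a b + p * q * (dot3 a a + dot3 b b) -
        r ^ 2 * (dot3 a a * dot3 b b - dot3 a b ^ 2) := by
  simp [dot3, cross_apply]
  ring

theorem stmt_13 (Δt : ℝ) (hΔt : 0 < Δt) (S₁ S₂ : Fin 3 → ℝ)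
    (h₁ : dot3 S₁ S₁ = 1) (h₂ : dot3 S₂ S₂ = 1) (h₁₂ : dot3 S₁ S₂ ≠ -1) :
    dot3 (KPmap Δt S₁ S₂).1 (KPmap Δt S₁ S₂).2 = dot3 S₁ S₂ := by
  have hpos : 0 < (1 + dot3 S₁ S₂) / 2 + Δt ^ 2 := by
    linarith [neg_one_le_dot3 h₁ h₂, pow_pos hΔt 2]
  simp only [KPmap]
  rw [dot3_smul_smul, dot3_add_crossProduct, h₁, h₂, one_div, inv_pow,
    inv_mul_eq_iff_eq_mul₀ (pow_ne_zero 2 hpos.ne')]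
  ring
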